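/- For every log-concave random variable X with mean 0 and every function ψ: ℝ → ℝ that is convex on (0,∞) and zero on (-∞,0], there exist unique a, b ≥ 0 such that P(X > 0) = P(X_{a,b} > 0) and E|X| = E|X_{a,b}|, and moreover E[ψ(X/E|X|)] ≤ E[ψ(X_{a,b}/E|X_{a,b}|)], where X_{a,b} = a(ℰ−1) − b(ℰ'−1) with ℰ, ℰ' i.i.d. standard exponentials. -/

import Mathlib

open MeasureTheory ProbabilityTheory Real Set

/-- Density of a standard exponential random variable. -/
noncomputable def expPDF : ℝ → ℝ := fun x => if 0 < x then Real.exp (-x) else 0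

/-- `X` has density `f` with respect to Lebesgue measure. -/
def HasDensity {Ω : Type*} [MeasurableSpace Ω] (P : Measure Ω) (X : Ω → ℝ) (f : ℝ → ℝ) : Prop :=
  Measurable X ∧ Measure.map X P = volume.withDensity (fun x => ENNReal.ofReal (f x))

/-- `f` is a (nonnegative) log-concave function on `ℝ`. -/
def IsLogConcaveFn (f : ℝ → ℝ) : Prop :=
  (∀ x, 0 ≤ f x) ∧
  ∀ x y l : ℝ, 0 ≤ l → l ≤ 1 → f x ^ l * f y ^ (1 - l) ≤ f (l * x + (1 - l) * y)

lemma lc_measurable {f : ℝ → ℝ} (hf : IsLogConcaveFn f) : Measurable f := by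
  refine measurable_of_Ioi fun t => ?_
  rcases lt_or_ge t 0 with ht | ht
  · have : f ⁻¹' Ioi t = univ := by
      ext x; simp; linarith [hf.1 x]
    rw [this]; exact MeasurableSet.univ
  · apply OrdConnected.measurableSet
    apply Convex.ordConnected
    intro x hx y hy l m hl hm hlm
    have hx' : t < f x := hx
    have hy' : t < f y := hy
    have hm' : m = 1 - l := by linarith
    subst hm'
    have h := hf.2 x y l hl (by linarith)
    show t < f (l * x + (1 - l) * y)
    refine lt_of_lt_of_le ?_ h
    set s := min (f x) (f y) with hs
    have hts : t < s := lt_min hx' hy'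
    have hs0 : 0 < s := by linarith
    calc t < s := hts
      _ = s ^ l * s ^ (1 - l) := by rw [← Real.rpow_add hs0]; simp
      _ ≤ _ := by
        apply mul_le_mul
        · exact Real.rpow_le_rpow hs0.le (min_le_left _ _) hl
        · exact Real.rpow_le_rpow hs0.le (min_le_right _ _) hm
        · positivity
        · exact Real.rpow_nonneg (hf.1 x) _

lemma lc_neg {f : ℝ → ℝ} (hf : IsLogConcaveFn f) : IsLogConcaveFn (fun x => f (-x)) := by
  refine ⟨fun x => hf.1 _, fun x y l h0 h1 => ?_⟩
  have := hf.2 (-x) (-y) l h0 h1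
  have e : -(l * x + (1 - l) * y) = l * -x + (1 - l) * -y := by ring
  simp only [e]; exact this

lemma exp_interp (C s x z l : ℝ) (hC : 0 < C) :
    (C * Real.exp (s * x)) ^ l * (C * Real.exp (s * z)) ^ (1 - l)
      = C * Real.exp (s * (l * x + (1 - l) * z)) := by
  rw [Real.mul_rpow hC.le (Real.exp_pos _).le, Real.mul_rpow hC.le (Real.exp_pos _).le,
    ← Real.exp_mul, ← Real.exp_mul]
  have h1 : C ^ l * C ^ (1 - l) = C := by rw [← Real.rpow_add hC]; simp
  have h2 : Real.exp (s * x * l) * Real.exp (s * z * (1 - l))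
      = Real.exp (s * (l * x + (1 - l) * z)) := by
    rw [← Real.exp_add]; ring_nf
  calc _ = (C ^ l * C ^ (1 - l)) * (Real.exp (s * x * l) * Real.exp (s * z * (1 - l))) := by ring
    _ = _ := by rw [h1, h2]

lemma interp_exists {x y z : ℝ} (h1 : x < y) (h2 : y < z) :
    ∃ l : ℝ, 0 < l ∧ l < 1 ∧ l * x + (1 - l) * z = y := by
  refine ⟨(z - y) / (z - x), ?_, ?_, ?_⟩
  · apply div_pos <;> linarith
  · rw [div_lt_one] <;> linarith
  · have : z - x ≠ 0 := by linarith
    field_simp; ring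

/-- between: weak version -/
lemma lc_between {f : ℝ → ℝ} (hf : IsLogConcaveFn f) {C s x y z : ℝ} (hC : 0 < C)
    (h1 : x < y) (h2 : y < z) (hx : C * Real.exp (s * x) ≤ f x) (hz : C * Real.exp (s * z) ≤ f z) :
    C * Real.exp (s * y) ≤ f y := by
  obtain ⟨l, l0, l1, rfl⟩ := interp_exists h1 h2
  refine le_trans ?_ (hf.2 x z l l0.le l1.le)
  rw [← exp_interp C s x z l hC]
  apply mul_le_mul
  · exact Real.rpow_le_rpow (by positivity) hx l0.le
  · exact Real.rpow_le_rpow (by positivity) hz (by linarith)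
  · positivity
  · exact Real.rpow_nonneg (hf.1 x) _

lemma lc_between_strict {f : ℝ → ℝ} (hf : IsLogConcaveFn f) {C s x y z : ℝ} (hC : 0 < C)
    (h1 : x < y) (h2 : y < z) (hx : C * Real.exp (s * x) < f x) (hz : C * Real.exp (s * z) ≤ f z) :
    C * Real.exp (s * y) < f y := by
  obtain ⟨l, l0, l1, rfl⟩ := interp_exists h1 h2
  refine lt_of_lt_of_le ?_ (hf.2 x z l l0.le l1.le)
  rw [← exp_interp C s x z l hC]
  apply mul_lt_mul
  · exact Real.rpow_lt_rpow (by positivity) hx l0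
  · exact Real.rpow_le_rpow (by positivity) hz (by linarith)
  · positivity
  · exact Real.rpow_nonneg (hf.1 x) _

/-- If an affine function times `h` is nonneg, and all moments vanish, `h = 0` a.e. -/
lemma ae_zero_of_affine {h : ℝ → ℝ} (hi : IntegrableOn h (Ioi 0))
    (hxi : IntegrableOn (fun x => x * h x) (Ioi 0))
    (h0 : ∫ x in Ioi (0:ℝ), h x = 0) (h1 : ∫ x in Ioi (0:ℝ), x * h x = 0)
    (c0 c1 : ℝ) (r : ℝ) (hne : ∀ x, x ≠ r → c0 + c1 * x ≠ 0)
    (hs : ∀ x, 0 < x → x ≠ r → 0 ≤ (c0 + c1 * x) * h x) :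
    ∀ᵐ x ∂(volume.restrict (Ioi (0:ℝ))), h x = 0 := by
  have hr : ∀ᵐ x ∂(volume.restrict (Ioi (0:ℝ))), x ≠ r :=
    ae_restrict_of_ae (by simp [ae_iff])
  have hm : ∀ᵐ x ∂(volume.restrict (Ioi (0:ℝ))), x ∈ Ioi (0:ℝ) := ae_restrict_mem measurableSet_Ioi
  have e : (fun x => (c0 + c1 * x) * h x) = fun x => c0 * h x + c1 * (x * h x) := by
    ext x; ring
  have hint : IntegrableOn (fun x => (c0 + c1 * x) * h x) (Ioi 0) := by
    rw [e]; exact (hi.const_mul c0).add (hxi.const_mul c1)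
  have hz : ∫ x in Ioi (0:ℝ), (c0 + c1 * x) * h x = 0 := by
    rw [e, integral_add (hi.const_mul c0) (hxi.const_mul c1), integral_const_mul,
      integral_const_mul, h0, h1]; simp
  rw [integral_eq_zero_iff_of_nonneg_ae _ hint] at hz
  · filter_upwards [hz, hr] with x hx hxr
    have := hne x hxr
    simpa [this] using hx
  · filter_upwards [hr, hm] with x hxr hx using hs x hx hxr

/-- Key lemma: the extension to the left of the matching exponential dominates. -/
lemma key_left {f : ℝ → ℝ} (hf : IsLogConcaveFn f) {C s : ℝ} (hC : 0 < C)
    (hfi : IntegrableOn f (Ioi 0)) (hxi : IntegrableOn (fun x => x * f x) (Ioi 0))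
    (hgi : IntegrableOn (fun x => C * Real.exp (s * x)) (Ioi 0))
    (hxgi : IntegrableOn (fun x => x * (C * Real.exp (s * x))) (Ioi 0))
    (h0 : ∫ x in Ioi (0:ℝ), f x = ∫ x in Ioi (0:ℝ), C * Real.exp (s * x))
    (h1 : ∫ x in Ioi (0:ℝ), x * f x = ∫ x in Ioi (0:ℝ), x * (C * Real.exp (s * x)))
    (x₀ : ℝ) (hx₀ : x₀ ≤ 0) : f x₀ ≤ C * Real.exp (s * x₀) := by
  by_contra! hlt
  set g : ℝ → ℝ := fun x => C * Real.exp (s * x) with hg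
  have key : ∀ᵐ x ∂(volume.restrict (Ioi (0:ℝ))), f x - g x = 0 := by
    have hi : IntegrableOn (fun x => f x - g x) (Ioi 0) := hfi.sub hgi
    have e : (fun x => x * (f x - g x)) = fun x => x * f x - x * g x := by ext x; ring
    have hi' : IntegrableOn (fun x => x * (f x - g x)) (Ioi 0) := by
      rw [e]; exact hxi.sub hxgi
    have z0 : ∫ x in Ioi (0:ℝ), (f x - g x) = 0 := by
      rw [integral_sub hfi hgi, h0]; simp
    have z1 : ∫ x in Ioi (0:ℝ), x * (f x - g x) = 0 := by
      rw [e, integral_sub hxi hxgi, h1]; simp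
    set T : Set ℝ := {y | 0 < y ∧ g y ≤ f y} with hT
    have low : ∀ y ∈ T, ∀ w, 0 < w → w ≤ y → g w ≤ f w := by
      intro y hy w hw hwy
      rcases hwy.eq_or_lt with rfl | h
      · exact hy.2
      · exact lc_between hf hC (by linarith) h hlt.le hy.2
    by_cases hb : BddAbove T
    · by_cases hne : T.Nonempty
      · refine ae_zero_of_affine hi hi' z0 z1 (sSup T) (-1) (sSup T) ?_ ?_
        · intro x hx h; apply hx; linarith
        · intro x hx hxr
          rcases lt_or_gt_of_ne hxr with h | h
          · obtain ⟨y, hy, hxy⟩ := exists_lt_of_lt_csSup hne h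
            have := low y hy x hx hxy.le
            apply mul_nonneg <;> linarith
          · have : x ∉ T := fun hxT => absurd (le_csSup hb hxT) (by linarith)
            have : f x < g x := by
              by_contra! hh; exact this ⟨hx, hh⟩
            apply mul_nonneg_of_nonpos_of_nonpos <;> linarith
      · refine ae_zero_of_affine hi hi' z0 z1 (-1) 0 0 (by simp) ?_
        intro x hx _
        have : f x < g x := by
          by_contra! hh; exact hne ⟨x, hx, hh⟩
        linarith
    · refine ae_zero_of_affine hi hi' z0 z1 1 0 0 (by simp) ?_
      intro x hx _
      rw [not_bddAbove_iff] at hb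
      obtain ⟨y, hy, hxy⟩ := hb x
      have := low y hy x hx hxy.le
      linarith
  have pt : ∀ u v : ℝ, 0 ≤ u → u < v → ∃ y, u < y ∧ y < v ∧ f y = g y := by
    intro u v hu huv
    by_contra! hcon
    have k2 : ∀ᵐ x ∂(volume : Measure ℝ), x ∈ Ioi (0:ℝ) → f x - g x = 0 :=
      (ae_restrict_iff' measurableSet_Ioi).1 key
    have : volume (Ioo u v) = 0 := by
      refine measure_mono_null ?_ (ae_iff.1 k2)
      intro x hx
      simp only [Set.mem_ofPred_eq, Classical.not_imp]
      refine ⟨lt_of_le_of_lt hu hx.1, fun h => hcon x hx.1 hx.2 (by linarith)⟩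
    simp at this
    linarith
  obtain ⟨y, y0, y1, hy⟩ := pt 0 1 le_rfl one_pos
  obtain ⟨z, z0, z1, hz⟩ := pt 1 2 zero_le_one one_lt_two
  have := lc_between_strict hf hC (show x₀ < y by linarith) (show y < z by linarith) hlt
    (le_of_eq hz.symm)
  exact absurd hy (ne_of_gt this)

/-- The crossing lemma. -/
lemma crossing {f g ψ : ℝ → ℝ} (hψ : ConvexOn ℝ (Ioi 0) ψ)
    (hfi : IntegrableOn f (Ioi 0)) (hxi : IntegrableOn (fun x => x * f x) (Ioi 0))
    (hgi : IntegrableOn g (Ioi 0)) (hxgi : IntegrableOn (fun x => x * g x) (Ioi 0))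
    (h0 : ∫ x in Ioi (0:ℝ), f x = ∫ x in Ioi (0:ℝ), g x)
    (h1 : ∫ x in Ioi (0:ℝ), x * f x = ∫ x in Ioi (0:ℝ), x * g x)
    (hfψ : IntegrableOn (fun x => ψ x * f x) (Ioi 0))
    (hgψ : IntegrableOn (fun x => ψ x * g x) (Ioi 0))
    (hS : ∀ x y z, 0 < x → x < y → y < z → g x < f x → g z < f z → g y ≤ f y) :
    ∫ x in Ioi (0:ℝ), ψ x * f x ≤ ∫ x in Ioi (0:ℝ), ψ x * g x := by
  have hi : IntegrableOn (fun x => g x - f x) (Ioi 0) := hgi.sub hfi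
  have e : (fun x => x * (g x - f x)) = fun x => x * g x - x * f x := by ext x; ring
  have hi' : IntegrableOn (fun x => x * (g x - f x)) (Ioi 0) := by
    rw [e]; exact hxgi.sub hxi
  have z0 : ∫ x in Ioi (0:ℝ), (g x - f x) = 0 := by
    rw [integral_sub hgi hfi, h0]; simp
  have z1 : ∫ x in Ioi (0:ℝ), x * (g x - f x) = 0 := by
    rw [e, integral_sub hxgi hxi, h1]; simp
  have triv : (∃ c0 c1 r : ℝ, (∀ x, x ≠ r → c0 + c1 * x ≠ 0) ∧
      (∀ x, 0 < x → x ≠ r → 0 ≤ (c0 + c1 * x) * (g x - f x))) →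
      ∫ x in Ioi (0:ℝ), ψ x * f x ≤ ∫ x in Ioi (0:ℝ), ψ x * g x := by
    rintro ⟨c0, c1, r, hne, hs⟩
    have := ae_zero_of_affine hi hi' z0 z1 c0 c1 r hne hs
    apply le_of_eq
    apply integral_congr_ae
    filter_upwards [this] with x hx
    have : f x = g x := by linarith
    simp [this]
  set S : Set ℝ := {x | 0 < x ∧ g x < f x} with hSdef
  have out : ∀ x, 0 < x → x ∉ S → 0 ≤ g x - f x := by
    intro x hx hxS
    by_contra! hh
    exact hxS ⟨hx, by linarith⟩
  by_cases hne : S.Nonempty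
  swap
  · exact triv ⟨1, 0, 0, by simp, fun x hx _ => by
      have := out x hx (fun h => hne ⟨x, h⟩); linarith⟩
  have hbb : BddBelow S := ⟨0, fun x hx => hx.1.le⟩
  have hα0 : 0 ≤ sInf S := le_csInf hne fun x hx => hx.1.le
  set α := sInf S with hα
  have below : ∀ x, 0 < x → x < α → 0 ≤ g x - f x := fun x hx hxα =>
    out x hx (fun h => absurd (csInf_le hbb h) (by linarith))
  by_cases hb : BddAbove S
  swap
  · apply triv
    refine ⟨α, -1, α, fun x hx h => hx (by linarith), fun x hx hxr => ?_⟩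
    rcases lt_or_gt_of_ne hxr with h | h
    · apply mul_nonneg _ (below x hx h); linarith
    · obtain ⟨y, hy, hyx⟩ := exists_lt_of_csInf_lt hne h
      rw [not_bddAbove_iff] at hb
      obtain ⟨z, hz, hxz⟩ := hb x
      have := hS y x z hy.1 hyx hxz hy.2 hz.2
      apply mul_nonneg_of_nonpos_of_nonpos <;> linarith
  set β := sSup S with hβ
  have above : ∀ x, 0 < x → β < x → 0 ≤ g x - f x := fun x hx hxα =>
    out x hx (fun h => absurd (le_csSup hb h) (by linarith))
  have mid : ∀ x, α < x → x < β → g x - f x ≤ 0 := by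
    intro x h1 h2
    obtain ⟨y, hy, hyx⟩ := exists_lt_of_csInf_lt hne h1
    obtain ⟨z, hz, hxz⟩ := exists_lt_of_lt_csSup hne h2
    have := hS y x z hy.1 hyx hxz hy.2 hz.2
    linarith
  have hαβ : α ≤ β := by
    obtain ⟨x, hx⟩ := hne
    exact (csInf_le hbb hx).trans (le_csSup hb hx)
  rcases hαβ.eq_or_lt with heq | hlt
  · refine triv ⟨1, 0, α, by simp, fun x hx hxr => ?_⟩
    rcases lt_or_gt_of_ne hxr with h | h
    · linarith [below x hx h]
    · linarith [above x hx (by linarith)]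
  rcases hα0.eq_or_lt with h00 | hpos
  · refine triv ⟨-β, 1, β, fun x hx h => hx (by linarith), fun x hx hxr => ?_⟩
    rcases lt_or_gt_of_ne hxr with h | h
    · apply mul_nonneg_of_nonpos_of_nonpos
      · linarith
      · exact mid x (by linarith) h
    · apply mul_nonneg _ (above x hx h); linarith
  -- main case
  set k := (ψ β - ψ α) / (β - α) with hk
  have hkk : k * (β - α) = ψ β - ψ α := by rw [hk]; field_simp [show β - α ≠ 0 by linarith]
  set c := ψ α - k * α with hc
  have hβ0 : 0 < β := by linarith
  have conv : ∀ x y z, 0 < x → x < y → y < z →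
      ψ y * (z - x) ≤ ψ x * (z - y) + ψ z * (y - x) := by
    intro x y z hx hxy hyz
    have hzx : 0 < z - x := by linarith
    have := hψ.2 (show x ∈ Ioi (0:ℝ) from hx) (show z ∈ Ioi (0:ℝ) from by simp; linarith)
      (show 0 ≤ (z - y) / (z - x) by apply div_nonneg <;> linarith)
      (show 0 ≤ (y - x) / (z - x) by apply div_nonneg <;> linarith)
      (by field_simp; ring)
    have ey : (z - y) / (z - x) * x + (y - x) / (z - x) * z = y := by field_simp; ring
    simp only [smul_eq_mul, ey] at this
    calc ψ y * (z - x) ≤ ((z - y) / (z - x) * ψ x + (y - x) / (z - x) * ψ z) * (z - x) :=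
          mul_le_mul_of_nonneg_right this hzx.le
      _ = _ := by field_simp
  have hnn : ∀ x, 0 < x → 0 ≤ (ψ x - (c + k * x)) * (g x - f x) := by
    intro x hx
    have hba : 0 < β - α := by linarith
    have hid : (ψ x - (c + k * x)) * (β - α)
        = ψ x * (β - α) - ψ α * (β - x) - ψ β * (x - α) := by
      rw [hc]; linear_combination (α - x) * hkk
    have hpos' : 0 ≤ ψ x * (β - α) - ψ α * (β - x) - ψ β * (x - α) → 0 ≤ ψ x - (c + k * x) := by
      intro h; rw [← hid] at h; exact nonneg_of_mul_nonneg_left h hba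
    have hneg' : ψ x * (β - α) - ψ α * (β - x) - ψ β * (x - α) ≤ 0 → ψ x - (c + k * x) ≤ 0 := by
      intro h; rw [← hid] at h; exact nonpos_of_mul_nonpos_left h hba
    rcases lt_trichotomy x α with h | h | h
    · refine mul_nonneg (hpos' ?_) (below x hx h)
      linarith [conv x α β hx h hlt]
    · have : ψ x - (c + k * x) = 0 := by rw [hc, h]; ring
      rw [this]; simp
    · rcases lt_trichotomy x β with h' | h' | h'
      · refine mul_nonneg_of_nonpos_of_nonpos (hneg' ?_) (mid x h h')
        linarith [conv α x β hpos h h']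
      · have : ψ x - (c + k * x) = 0 := by rw [hc, h']; linarith
        rw [this]; simp
      · refine mul_nonneg (hpos' ?_) (above x hx h')
        linarith [conv α β x hpos hlt h']
  have hfin : 0 ≤ ∫ x in Ioi (0:ℝ), (ψ x - (c + k * x)) * (g x - f x) :=
    setIntegral_nonneg measurableSet_Ioi fun x hx => hnn x hx
  have e2 : (fun x => (ψ x - (c + k * x)) * (g x - f x))
      = fun x => (ψ x * g x - ψ x * f x) - (c * (g x - f x) + k * (x * (g x - f x))) := by
    ext x; ring
  have j1 : IntegrableOn (fun x => ψ x * g x - ψ x * f x) (Ioi 0) := hgψ.sub hfψ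
  have j2 : IntegrableOn (fun x => c * (g x - f x) + k * (x * (g x - f x))) (Ioi 0) :=
    (hi.const_mul c).add (hi'.const_mul k)
  rw [e2, integral_sub j1 j2,
    integral_sub hgψ hfψ, integral_add (hi.const_mul c) (hi'.const_mul k), integral_const_mul,
    integral_const_mul, z0, z1] at hfin
  linarith

lemma exp_moments {a : ℝ} (ha : 0 < a) (C : ℝ) :
    IntegrableOn (fun x => C * Real.exp (-a⁻¹ * x)) (Ioi 0) ∧
    IntegrableOn (fun x => x * (C * Real.exp (-a⁻¹ * x))) (Ioi 0) ∧
    (∫ x in Ioi (0:ℝ), C * Real.exp (-a⁻¹ * x)) = C * a ∧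
    (∫ x in Ioi (0:ℝ), x * (C * Real.exp (-a⁻¹ * x))) = C * a ^ 2 := by
  have hn : -a⁻¹ < 0 := by simpa using ha
  have e : (fun x => x * (C * Real.exp (-a⁻¹ * x))) = fun x => C * (x * Real.exp (-a⁻¹ * x)) := by
    ext x; ring
  refine ⟨(integrableOn_exp_mul_Ioi hn 0).const_mul C, ?_, ?_, ?_⟩
  · rw [e]
    apply Integrable.const_mul
    have := integrableOn_rpow_mul_exp_neg_mul_rpow (p := 1) (s := 1) (b := a⁻¹) (by norm_num)
      (by norm_num) (by positivity)
    simpa [IntegrableOn] using this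
  · rw [integral_const_mul, integral_exp_mul_Ioi hn]
    simp
  · rw [e, integral_const_mul]
    have := Real.integral_rpow_mul_exp_neg_mul_Ioi (a := 2) (r := a⁻¹) (by norm_num) (by positivity)
    have h1 : (2:ℝ) - 1 = 1 := by norm_num
    simp only [h1, Real.rpow_one, Real.Gamma_two, one_div, inv_inv, mul_one, Real.rpow_two] at this
    rw [← this]
    congr 1
    apply integral_congr_ae
    filter_upwards with x
    simp

lemma key_left' {f : ℝ → ℝ} (hf : IsLogConcaveFn f) {a p : ℝ} (ha : 0 < a) (hp : 0 < p)
    (hfi : IntegrableOn f (Ioi 0)) (hxi : IntegrableOn (fun x => x * f x) (Ioi 0))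
    (h0 : ∫ x in Ioi (0:ℝ), f x = p) (h1 : ∫ x in Ioi (0:ℝ), x * f x = p * a)
    (x : ℝ) (hx : x ≤ 0) : f x ≤ p / a * Real.exp (-a⁻¹ * x) := by
  obtain ⟨i1, i2, i3, i4⟩ := exp_moments ha (p / a)
  refine key_left hf (by positivity) hfi hxi i1 i2 ?_ ?_ x hx
  · rw [h0, i3]; field_simp
  · rw [h1, i4]; field_simp

lemma grunbaum {f : ℝ → ℝ} (hf : IsLogConcaveFn f) {M p : ℝ} (hM : 0 < M) (hp : 0 < p)
    (hfi : IntegrableOn f (Ioi 0)) (hxi : IntegrableOn (fun x => x * f x) (Ioi 0))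
    (h0 : ∫ x in Ioi (0:ℝ), f x = p) (h1 : ∫ x in Ioi (0:ℝ), x * f x = M)
    (hfi' : IntegrableOn (fun x => f (-x)) (Ioi 0))
    (hxi' : IntegrableOn (fun x => x * f (-x)) (Ioi 0))
    (h0' : ∫ x in Ioi (0:ℝ), f (-x) = 1 - p) (h1' : ∫ x in Ioi (0:ℝ), x * f (-x) = M) :
    Real.exp (-1) ≤ p := by
  set a := M / p with ha'
  have ha : 0 < a := by positivity
  have hMa : M = p * a := by rw [ha']; field_simp
  have hp1 : p ≤ 1 := by
    have : 0 ≤ ∫ x in Ioi (0:ℝ), f (-x) := integral_nonneg fun x => hf.1 _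
    linarith
  have hdom : ∀ y, 0 < y → f (-y) ≤ p / a * Real.exp (a⁻¹ * y) := by
    intro y hy
    have := key_left' hf ha hp hfi hxi h0 (by rw [h1, hMa]) (-y) (by linarith)
    simpa using this
  set c := -(a * Real.log p) with hc
  have hc0 : 0 ≤ c := by
    have := Real.log_nonpos hp.le hp1
    rw [hc]; nlinarith
  have hexp : Real.exp (a⁻¹ * c) = p⁻¹ := by
    rw [hc]
    have : a⁻¹ * -(a * Real.log p) = - Real.log p := by field_simp
    rw [this, Real.exp_neg, Real.exp_log hp]
  have hI : ∫ y in (0:ℝ)..c, (y - c) * (p / a * Real.exp (a⁻¹ * y)) = -a + p * c + p * a := by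
    have hd : ∀ y ∈ uIcc 0 c, HasDerivAt (fun y => p * ((y - c - a) * Real.exp (a⁻¹ * y)))
        ((y - c) * (p / a * Real.exp (a⁻¹ * y))) y := by
      intro y _
      have e1 : HasDerivAt (fun y : ℝ => y - c - a) 1 y :=
        ((hasDerivAt_id y).sub_const c).sub_const a
      have e2 : HasDerivAt (fun y : ℝ => Real.exp (a⁻¹ * y)) (Real.exp (a⁻¹ * y) * (a⁻¹ * 1)) y :=
        ((hasDerivAt_id y).const_mul a⁻¹).exp
      have := (e1.mul e2).const_mul p
      refine this.congr_deriv ?_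
      field_simp; ring
    rw [intervalIntegral.integral_eq_sub_of_hasDerivAt hd
      (Continuous.intervalIntegrable (by fun_prop) _ _), hexp]
    simp
    field_simp
    ring
  have hJ : ∫ y in Ioi (0:ℝ), (y - c) * f (-y) = M - c * (1 - p) := by
    have e : (fun y => (y - c) * f (-y)) = fun y => y * f (-y) - c * f (-y) := by ext y; ring
    rw [e, integral_sub hxi' (hfi'.const_mul c), integral_const_mul, h0', h1']
  have hJi : IntegrableOn (fun y => (y - c) * f (-y)) (Ioi 0) := by
    have e : (fun y => (y - c) * f (-y)) = fun y => y * f (-y) - c * f (-y) := by ext y; ring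
    rw [e]; exact hxi'.sub (hfi'.const_mul c)
  have hle : ∫ y in (0:ℝ)..c, (y - c) * (p / a * Real.exp (a⁻¹ * y))
      ≤ ∫ y in Ioi (0:ℝ), (y - c) * f (-y) := by
    rw [intervalIntegral.integral_of_le hc0, ← Ioc_union_Ioi_eq_Ioi hc0,
      setIntegral_union (Ioc_disjoint_Ioi le_rfl) measurableSet_Ioi
        (hJi.mono_set Ioc_subset_Ioi_self) (hJi.mono_set (Ioi_subset_Ioi hc0))]
    have t1 : ∫ y in Ioc 0 c, (y - c) * (p / a * Real.exp (a⁻¹ * y))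
        ≤ ∫ y in Ioc 0 c, (y - c) * f (-y) := by
      apply setIntegral_mono_on
      · exact Continuous.integrableOn_Ioc (by fun_prop)
      · exact hJi.mono_set Ioc_subset_Ioi_self
      · exact measurableSet_Ioc
      · intro y hy
        apply mul_le_mul_of_nonpos_left (hdom y hy.1)
        linarith [hy.2]
    have t2 : 0 ≤ ∫ y in Ioi c, (y - c) * f (-y) :=
      setIntegral_nonneg measurableSet_Ioi fun y hy =>
        mul_nonneg (by have : c < y := hy; linarith) (hf.1 _)
    linarith
  rw [hI, hJ] at hle
  have hca : c ≤ a := by rw [hMa] at hle; linarith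
  have : -1 ≤ Real.log p := by
    rw [hc] at hca
    by_contra! h
    nlinarith
  rwa [Real.le_log_iff_exp_le hp] at this

section density
variable {Ω : Type} [MeasurableSpace Ω] {P : Measure Ω} {X : Ω → ℝ} {f : ℝ → ℝ}

lemma hd_integrable (hX : HasDensity P X f) (hf : Measurable f) (hf0 : ∀ x, 0 ≤ f x)
    {φ : ℝ → ℝ} (hφ : Measurable φ) :
    Integrable (fun ω => φ (X ω)) P ↔ Integrable (fun x => φ x * f x) := by
  have h1 : Integrable (fun ω => φ (X ω)) P ↔ Integrable φ (Measure.map X P) :=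
    (integrable_map_measure hφ.aestronglyMeasurable hX.1.aemeasurable).symm
  rw [h1, hX.2, integrable_withDensity_iff_integrable_smul' hf.ennreal_ofReal (by simp)]
  apply iff_of_eq; congr 1; ext x
  rw [ENNReal.toReal_ofReal (hf0 x), smul_eq_mul, mul_comm]

lemma hd_integral (hX : HasDensity P X f) (hf : Measurable f) (hf0 : ∀ x, 0 ≤ f x)
    {φ : ℝ → ℝ} (hφ : Measurable φ) :
    ∫ ω, φ (X ω) ∂P = ∫ x, φ x * f x := by
  have h1 : ∫ ω, φ (X ω) ∂P = ∫ x, φ x ∂(Measure.map X P) :=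
    (integral_map hX.1.aemeasurable hφ.aestronglyMeasurable).symm
  rw [h1, hX.2, integral_withDensity_eq_integral_toReal_smul hf.ennreal_ofReal (by simp)]
  congr 1; ext x
  rw [ENNReal.toReal_ofReal (hf0 x), smul_eq_mul, mul_comm]

lemma hd_neg (hX : HasDensity P X f) :
    HasDensity P (fun ω => - X ω) (fun x => f (-x)) := by
  refine ⟨hX.1.neg, ?_⟩
  have h1 : Measure.map (fun ω => - X ω) P = Measure.map (fun x => -x) (Measure.map X P) := by
    rw [Measure.map_map measurable_neg hX.1]; rfl
  rw [h1, hX.2]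
  ext s hs
  have hs' : MeasurableSet ((fun x : ℝ => -x) ⁻¹' s) := measurable_neg hs
  rw [Measure.map_apply measurable_neg hs, withDensity_apply _ hs', withDensity_apply _ hs]
  have := (Measure.measurePreserving_neg (volume : Measure ℝ)).setLIntegral_comp_preimage_emb
    (MeasurableEquiv.neg ℝ).measurableEmbedding (fun x => ENNReal.ofReal (f (-x))) s
  simpa using this

lemma hd_add_const (hX : HasDensity P X f) (c : ℝ) :
    HasDensity P (fun ω => X ω + c) (fun x => f (x - c)) := by
  refine ⟨hX.1.add_const c, ?_⟩
  have h1 : Measure.map (fun ω => X ω + c) P = Measure.map (fun x => x + c) (Measure.map X P) := by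
    rw [Measure.map_map (measurable_add_const c) hX.1]; rfl
  rw [h1, hX.2]
  ext s hs
  have hs' : MeasurableSet ((fun x : ℝ => x + c) ⁻¹' s) := measurable_add_const c hs
  rw [Measure.map_apply (measurable_add_const c) hs, withDensity_apply _ hs', withDensity_apply _ hs]
  have := (measurePreserving_add_right (volume : Measure ℝ) c).setLIntegral_comp_preimage_emb
    (MeasurableEquiv.addRight c).measurableEmbedding (fun x => ENNReal.ofReal (f (x - c))) s
  simpa using this

/-- Summary of half-line data. -/
lemma hd_data [IsProbabilityMeasure P] (hX : HasDensity P X f) (hf : Measurable f)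
    (hf0 : ∀ x, 0 ≤ f x) (hXi : Integrable X P) (hm : ∫ ω, X ω ∂P = 0) :
    IntegrableOn f (Ioi 0) ∧ IntegrableOn (fun x => x * f x) (Ioi 0) ∧
    P.real {ω | 0 < X ω} = ∫ x in Ioi (0:ℝ), f x ∧
    ∫ ω, |X ω| ∂P = 2 * ∫ x in Ioi (0:ℝ), x * f x := by
  have i0 : Integrable f := by
    have := (hd_integrable hX hf hf0 (φ := fun _ => 1) measurable_const).1 (integrable_const _)
    simpa using this
  have i1 : Integrable (fun x => x * f x) :=
    (hd_integrable hX hf hf0 (φ := fun x => x) measurable_id).1 hXi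
  refine ⟨i0.integrableOn, i1.integrableOn, ?_, ?_⟩
  · have hms : MeasurableSet {ω | 0 < X ω} := measurableSet_lt measurable_const hX.1
    have := hd_integral hX hf hf0 (φ := (Ioi (0:ℝ)).indicator 1)
      (measurable_one.indicator measurableSet_Ioi)
    rw [← integral_indicator_one hms, ← integral_indicator measurableSet_Ioi]
    have e : ∀ x, (Ioi (0:ℝ)).indicator f x = (Ioi (0:ℝ)).indicator 1 x * f x := by
      intro x
      by_cases hx : 0 < x <;> simp [hx]
    simp only [e]
    exact this
  · have hmax : Measurable (fun x : ℝ => max x 0) := measurable_id.max measurable_const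
    have e1 := hd_integral hX hf hf0 hmax
    have e2 : ∫ x, max x 0 * f x = ∫ x in Ioi (0:ℝ), x * f x := by
      rw [← integral_indicator measurableSet_Ioi]
      congr 1; ext x
      by_cases hx : 0 < x
      · simp [hx, hx.le]
      · simp [hx, not_lt.1 hx]
    have e3 : (fun ω => |X ω|) = fun ω => 2 * max (X ω) 0 - X ω := by
      ext ω
      rcases le_total (X ω) 0 with h | h
      · rw [abs_of_nonpos h, max_eq_right h]; ring
      · rw [abs_of_nonneg h, max_eq_left h]; ring
    rw [e3, integral_sub ((hXi.pos_part).const_mul 2) hXi, integral_const_mul, hm, e1, e2]; ring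

lemma hd_prob_neg [IsProbabilityMeasure P] (hX : HasDensity P X f) :
    P.real {ω | 0 < - X ω} = 1 - P.real {ω | 0 < X ω} := by
  have hms : MeasurableSet {ω | 0 < X ω} := measurableSet_lt measurable_const hX.1
  rw [← probReal_compl_eq_one_sub hms]
  apply measureReal_congr
  have : P {ω | X ω = 0} = 0 := by
    have h : {ω | X ω = 0} = X ⁻¹' {0} := rfl
    rw [h, ← Measure.map_apply hX.1 (measurableSet_singleton 0), hX.2,
      withDensity_apply _ (measurableSet_singleton 0)]
    simp
  have h2 : ∀ᵐ ω ∂P, X ω ≠ 0 := by rw [ae_iff]; simpa using this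
  filter_upwards [h2] with ω hω
  apply propext
  show 0 < - X ω ↔ ¬ (0 < X ω)
  constructor
  · intro h; linarith
  · intro h
    have : X ω < 0 := lt_of_le_of_ne (not_lt.1 h) hω
    linarith

end density

/-- Density of the weighted difference for `a > 0`, `b ≥ 0`. -/
noncomputable def lapPDF (a b : ℝ) : ℝ → ℝ := fun u =>
  if 0 < u then Real.exp (-u / a) / (a + b)
  else if b = 0 then 0 else Real.exp (u / b) / (a + b)

lemma lapPDF_measurable (a b : ℝ) : Measurable (lapPDF a b) := by
  unfold lapPDF
  refine Measurable.ite measurableSet_Ioi (by fun_prop) ?_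
  by_cases hb : b = 0
  · simp [hb]
  · simp only [hb, if_false]; fun_prop

lemma lapPDF_nonneg {a b : ℝ} (ha : 0 < a) (hb : 0 ≤ b) (x : ℝ) : 0 ≤ lapPDF a b x := by
  unfold lapPDF
  split_ifs <;> positivity

lemma expPDF_measurable : Measurable expPDF := by
  unfold expPDF
  exact Measurable.ite measurableSet_Ioi (by fun_prop) measurable_const

lemma expPDF_nonneg (x : ℝ) : 0 ≤ expPDF x := by
  unfold expPDF
  split_ifs <;> positivity

lemma lint_exp {c K : ℝ} (hc : 0 < c) (hK : 0 ≤ K) (t : ℝ) :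
    ∫⁻ y, (Ioi t).indicator (fun y => ENNReal.ofReal (K * Real.exp (-c * y))) y
      = ENNReal.ofReal (K * Real.exp (-c * t) / c) := by
  rw [lintegral_indicator measurableSet_Ioi, ← ofReal_integral_eq_lintegral_ofReal,
    integral_const_mul, integral_exp_mul_Ioi (by linarith)]
  · congr 1; field_simp
  · exact (integrableOn_exp_mul_Ioi (by linarith) t).const_mul K
  · filter_upwards with y; positivity

lemma inner_lap {a b : ℝ} (ha : 0 < a) (hb : 0 ≤ b) (u : ℝ) :
    ∫⁻ y, ENNReal.ofReal (expPDF y) * (ENNReal.ofReal (expPDF ((u + b * y) / a)) * ENNReal.ofReal a⁻¹)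
      = ENNReal.ofReal (lapPDF a b u) := by
  have hc : 0 < b / a + 1 := by positivity
  have hK : 0 ≤ a⁻¹ * Real.exp (-u / a) := by positivity
  have gen : ∀ t, (∀ y, (0 < y ∧ 0 < u + b * y) ↔ t < y) →
      ∫⁻ y, ENNReal.ofReal (expPDF y) *
        (ENNReal.ofReal (expPDF ((u + b * y) / a)) * ENNReal.ofReal a⁻¹)
      = ENNReal.ofReal (a⁻¹ * Real.exp (-u / a) * Real.exp (-(b / a + 1) * t) / (b / a + 1)) := by
    intro t ht
    rw [← lint_exp hc hK t]
    congr 1; ext y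
    by_cases hy : t < y
    · obtain ⟨h1, h2⟩ := (ht y).2 hy
      have h3 : 0 < (u + b * y) / a := by positivity
      simp only [expPDF, h1, h3, if_true, indicator_of_mem (show y ∈ Ioi t from hy)]
      rw [← ENNReal.ofReal_mul (by positivity), ← ENNReal.ofReal_mul (by positivity)]
      congr 1
      rw [mul_comm (Real.exp _) a⁻¹, mul_left_comm, mul_assoc, ← Real.exp_add, ← Real.exp_add]
      congr 2
      field_simp; ring
    · rw [indicator_of_notMem (show y ∉ Ioi t from hy)]
      by_cases h1 : 0 < y
      · have h2 : ¬ (0 < (u + b * y) / a) := by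
          intro h
          apply hy
          rw [← ht y]
          refine ⟨h1, ?_⟩
          rcases div_pos_iff.1 h with h | h
          · exact h.1
          · linarith
        simp [expPDF, h2]
      · simp [expPDF, h1]
  by_cases hu : 0 < u
  · rw [gen 0]
    · simp only [lapPDF, hu, if_true]
      congr 1; simp; field_simp
      ring
    · intro y
      constructor
      · exact fun h => h.1
      · exact fun h => ⟨h, by positivity⟩
  · rcases hb.eq_or_lt with rfl | hb
    · have : ∀ y : ℝ, expPDF ((u + 0 * y) / a) = 0 := by
        intro y
        have : ¬ (0 < (u + 0 * y) / a) := by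
          simp only [zero_mul, add_zero, not_lt]
          exact div_nonpos_of_nonpos_of_nonneg (not_lt.1 hu) ha.le
        simp only [expPDF, this, if_false]
      simp only [this]
      simp [lapPDF, hu]
    · rw [gen (-u / b)]
      · simp only [lapPDF, hu, if_false, hb.ne']
        congr 1
        rw [mul_assoc, ← Real.exp_add]
        have : -u / a + -(b / a + 1) * (-u / b) = u / b := by field_simp; ring
        rw [this]; field_simp
        ring
      · intro y
        rw [div_lt_iff₀ hb]
        constructor
        · intro h; linarith [h.2]
        · intro h
          refine ⟨?_, by linarith⟩
          by_contra! hy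
          nlinarith [not_lt.1 hu]

lemma lint_affine {a : ℝ} (ha : 0 < a) (c : ℝ) {F : ℝ → ENNReal} (hF : Measurable F) :
    ∫⁻ x, F (a * x - c) = ∫⁻ u, F u * ENNReal.ofReal a⁻¹ := by
  have hF' : Measurable fun v => F (v - c) := hF.comp (measurable_sub_const c)
  have h1 : ∫⁻ x, F (a * x - c) = ∫⁻ v, F (v - c) ∂(Measure.map (fun x => a * x) volume) := by
    rw [lintegral_map hF' (measurable_const_mul a)]
  rw [h1, Real.map_volume_mul_left ha.ne', lintegral_smul_measure,
    lintegral_sub_right_eq_self F c, lintegral_mul_const _ hF, abs_of_pos (by positivity),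
    smul_eq_mul, mul_comm]

section law
set_option linter.unusedSectionVars false
variable {Ω : Type} [MeasurableSpace Ω] {P : Measure Ω} [IsProbabilityMeasure P] {E E' : Ω → ℝ}

lemma law_lap (hE : HasDensity P E expPDF) (hE' : HasDensity P E' expPDF)
    (hind : IndepFun E E' P) {a b : ℝ} (ha : 0 < a) (hb : 0 ≤ b) :
    HasDensity P (fun ω => a * E ω - b * E' ω) (lapPDF a b) := by
  have hm : Measurable (fun ω => a * E ω - b * E' ω) :=
    (hE.1.const_mul a).sub (hE'.1.const_mul b)
  refine ⟨hm, ?_⟩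
  have hpr := (indepFun_iff_map_prod_eq_prod_map_map hE.1.aemeasurable hE'.1.aemeasurable).1 hind
  have hlin : Measurable (fun q : ℝ × ℝ => a * q.1 - b * q.2) := by fun_prop
  have hpair : Measurable (fun ω => (E ω, E' ω)) := hE.1.prodMk hE'.1
  have hmap : Measure.map (fun ω => a * E ω - b * E' ω) P
      = Measure.map (fun q : ℝ × ℝ => a * q.1 - b * q.2)
        ((Measure.map E P).prod (Measure.map E' P)) := by
    rw [← hpr, Measure.map_map hlin hpair]; rfl
  have hpE : IsProbabilityMeasure (Measure.map E P) :=
    Measure.isProbabilityMeasure_map hE.1.aemeasurable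
  have hpE' : IsProbabilityMeasure (Measure.map E' P) :=
    Measure.isProbabilityMeasure_map hE'.1.aemeasurable
  rw [hmap]
  have hme : Measurable (fun x => ENNReal.ofReal (expPDF x)) := expPDF_measurable.ennreal_ofReal
  ext s hs
  set I : ℝ → ENNReal := s.indicator 1 with hI
  have hIm : Measurable I := measurable_one.indicator hs
  rw [← lintegral_indicator_one hs, lintegral_map hIm hlin,
    lintegral_prod_symm (fun q : ℝ × ℝ => I (a * q.1 - b * q.2)) (hIm.comp hlin).aemeasurable]
  have step1 : ∀ y, ∫⁻ x, I (a * x - b * y) ∂(Measure.map E P)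
      = ∫⁻ u, I u * (ENNReal.ofReal (expPDF ((u + b * y) / a)) * ENNReal.ofReal a⁻¹) := by
    intro y
    rw [hE.2, lintegral_withDensity_eq_lintegral_mul _ hme (by fun_prop)]
    have hF : Measurable (fun u => I u * ENNReal.ofReal (expPDF ((u + b * y) / a))) :=
      hIm.mul (hme.comp (by fun_prop))
    have := lint_affine ha (b * y) hF
    simp only [mul_assoc] at this
    rw [← this]
    congr 1; ext x
    have e : (a * x - b * y + b * y) / a = x := by field_simp; ring
    simp only [Pi.mul_apply, e]
    rw [mul_comm]
  simp only [step1]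
  have hm2 : Measurable (fun q : ℝ × ℝ =>
      I q.2 * (ENNReal.ofReal (expPDF ((q.2 + b * q.1) / a)) * ENNReal.ofReal a⁻¹)) := by
    refine (hIm.comp measurable_snd).mul (Measurable.mul_const ?_ _)
    exact hme.comp (by fun_prop)
  rw [hE'.2, lintegral_withDensity_eq_lintegral_mul _ hme hm2.lintegral_prod_right']
  have step2 : ∀ y, ((fun x => ENNReal.ofReal (expPDF x)) * fun y => ∫⁻ u, I u *
      (ENNReal.ofReal (expPDF ((u + b * y) / a)) * ENNReal.ofReal a⁻¹)) y
      = ∫⁻ u, ENNReal.ofReal (expPDF y) * (I u *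
      (ENNReal.ofReal (expPDF ((u + b * y) / a)) * ENNReal.ofReal a⁻¹)) := by
    intro y
    rw [Pi.mul_apply, lintegral_const_mul]
    exact hm2.comp (measurable_const.prodMk measurable_id)
  simp only [step2]
  rw [lintegral_lintegral_swap]
  · have step3 : ∀ u, ∫⁻ y, ENNReal.ofReal (expPDF y) * (I u *
      (ENNReal.ofReal (expPDF ((u + b * y) / a)) * ENNReal.ofReal a⁻¹))
        = s.indicator (fun u => ENNReal.ofReal (lapPDF a b u)) u := by
      intro u
      by_cases hu : u ∈ s
      · simp only [hI, indicator_of_mem hu, Pi.one_apply, one_mul]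
        exact inner_lap ha hb u
      · simp [hI, indicator_of_notMem hu]
    simp only [step3]
    rw [lintegral_indicator hs, withDensity_apply _ hs]
  · exact ((hme.comp measurable_fst).mul hm2).aemeasurable

lemma exp_mean (hE : HasDensity P E expPDF) :
    Integrable E P ∧ ∫ ω, E ω ∂P = 1 := by
  obtain ⟨i1, i2, i3, i4⟩ := exp_moments one_pos 1
  have hind : (fun x => x * expPDF x)
      = (Ioi (0:ℝ)).indicator (fun x => x * (1 * Real.exp (-(1:ℝ)⁻¹ * x))) := by
    ext x
    by_cases hx : 0 < x <;> simp [expPDF, hx]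
  constructor
  · have := hd_integrable hE expPDF_measurable expPDF_nonneg (φ := fun x => x) measurable_id
    rw [this, hind, integrable_indicator_iff measurableSet_Ioi]
    exact i2
  · have := hd_integral hE expPDF_measurable expPDF_nonneg (φ := fun x => x) measurable_id
    rw [this, hind, integral_indicator measurableSet_Ioi, i4]; simp

lemma Y_mean (hE : HasDensity P E expPDF) (hE' : HasDensity P E' expPDF) (a b : ℝ) :
    Integrable (fun ω => a * (E ω - 1) - b * (E' ω - 1)) P ∧
    ∫ ω, (a * (E ω - 1) - b * (E' ω - 1)) ∂P = 0 := by
  obtain ⟨i, m⟩ := exp_mean hE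
  obtain ⟨i', m'⟩ := exp_mean hE'
  have j : Integrable (fun ω => a * (E ω - 1)) P := (i.sub (integrable_const 1)).const_mul a
  have j' : Integrable (fun ω => b * (E' ω - 1)) P := (i'.sub (integrable_const 1)).const_mul b
  refine ⟨j.sub j', ?_⟩
  rw [integral_sub j j', integral_const_mul, integral_const_mul,
    integral_sub i (integrable_const 1), integral_sub i' (integrable_const 1), m, m']
  simp

lemma Y_density (hE : HasDensity P E expPDF) (hE' : HasDensity P E' expPDF)
    (hind : IndepFun E E' P) {a b : ℝ} (ha : 0 < a) (hb : 0 ≤ b) :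
    HasDensity P (fun ω => a * (E ω - 1) - b * (E' ω - 1)) (fun x => lapPDF a b (x - (b - a))) := by
  have := hd_add_const (law_lap hE hE' hind ha hb) (b - a)
  have e : (fun ω => a * (E ω - 1) - b * (E' ω - 1)) = fun ω => a * E ω - b * E' ω + (b - a) := by
    ext ω; ring
  rw [e]; exact this

/-- the one-variable function giving `P(Y>0)` -/
noncomputable def Kfun (t : ℝ) : ℝ := Real.exp (t - 1) / (1 + t)

lemma lap_form {a b : ℝ} (ha : 0 < a) (hb : 0 ≤ b) (x : ℝ) (h : 0 < x - (b - a)) :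
    lapPDF a b (x - (b - a)) = Kfun (b / a) / a * Real.exp (-a⁻¹ * x) := by
  simp only [lapPDF, h, if_true, Kfun]
  have e1 : -(x - (b - a)) / a = (b / a - 1) + (-a⁻¹ * x) := by field_simp; ring
  rw [e1, Real.exp_add]
  field_simp

lemma Y_half (hE : HasDensity P E expPDF) (hE' : HasDensity P E' expPDF)
    (hind : IndepFun E E' P) {a b : ℝ} (ha : 0 < a) (hb : 0 ≤ b) (hba : b ≤ a) :
    P.real {ω | 0 < a * (E ω - 1) - b * (E' ω - 1)} = Kfun (b / a) ∧
    ∫ ω, |a * (E ω - 1) - b * (E' ω - 1)| ∂P = 2 * a * Kfun (b / a) ∧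
    ∀ x, 0 < x → lapPDF a b (x - (b - a)) = Kfun (b / a) / a * Real.exp (-a⁻¹ * x) := by
  have hform : ∀ x, 0 < x →
      lapPDF a b (x - (b - a)) = Kfun (b / a) / a * Real.exp (-a⁻¹ * x) := by
    intro x hx
    exact lap_form ha hb x (by linarith)
  obtain ⟨i, m⟩ := Y_mean hE hE' a b
  have hden := Y_density hE hE' hind ha hb
  obtain ⟨d1, d2, d3, d4⟩ := hd_data hden
    ((lapPDF_measurable a b).comp (measurable_sub_const _)) (fun x => lapPDF_nonneg ha hb _) i m
  obtain ⟨i1, i2, i3, i4⟩ := exp_moments ha (Kfun (b / a) / a)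
  refine ⟨?_, ?_, hform⟩
  · rw [d3, setIntegral_congr_fun measurableSet_Ioi (fun x hx => hform x hx), i3]
    field_simp
  · rw [d4, setIntegral_congr_fun measurableSet_Ioi
      (fun x hx => congrArg (fun v => x * v) (hform x hx)), i4]
    field_simp

end law

lemma Kfun_strictMono : StrictMonoOn Kfun (Ici 0) := by
  apply strictMonoOn_of_deriv_pos (convex_Ici 0)
  · unfold Kfun
    apply ContinuousOn.div (by fun_prop) (by fun_prop)
    intro x hx; have : (0:ℝ) ≤ x := hx; positivity
  · intro x hx
    simp only [interior_Ici, mem_Ioi] at hx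
    have h1 : HasDerivAt (fun t : ℝ => Real.exp (t - 1)) (Real.exp (x - 1) * 1) x :=
      ((hasDerivAt_id x).sub_const 1).exp
    have h2 : HasDerivAt (fun t : ℝ => 1 + t) 1 x := (hasDerivAt_id x).const_add 1
    have h3 := h1.div h2 (by positivity)
    have : deriv Kfun x = _ := h3.deriv
    rw [this]
    apply div_pos _ (by positivity)
    have := Real.exp_pos (x - 1)
    nlinarith

lemma Kfun_one : Kfun 1 = 1 / 2 := by unfold Kfun; norm_num

lemma Kfun_zero : Kfun 0 = Real.exp (-1) := by unfold Kfun; norm_num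

lemma Kfun_surj {p : ℝ} (h1 : Real.exp (-1) ≤ p) (h2 : p ≤ 1 / 2) :
    ∃ t, 0 ≤ t ∧ t ≤ 1 ∧ Kfun t = p := by
  have hc : ContinuousOn Kfun (Icc 0 1) := by
    unfold Kfun
    apply ContinuousOn.div (by fun_prop) (by fun_prop)
    intro x hx; have : (0:ℝ) ≤ x := hx.1; positivity
  obtain ⟨t, ht, h⟩ := intermediate_value_Icc zero_le_one hc
    (show p ∈ Icc (Kfun 0) (Kfun 1) by rw [Kfun_zero, Kfun_one]; exact ⟨h1, h2⟩)
  exact ⟨t, ht.1, ht.2, h⟩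

section final
variable {Ω : Type} [MeasurableSpace Ω] {P : Measure Ω} [IsProbabilityMeasure P]

lemma Y_half' {E E' : Ω → ℝ} (hE : HasDensity P E expPDF) (hE' : HasDensity P E' expPDF)
    (hind : IndepFun E E' P) {a b : ℝ} (hb : 0 < b) (ha : 0 ≤ a) (hba : a ≤ b) :
    P.real {ω | 0 < a * (E ω - 1) - b * (E' ω - 1)} = 1 - Kfun (a / b) ∧
    ∫ ω, |a * (E ω - 1) - b * (E' ω - 1)| ∂P = 2 * b * Kfun (a / b) ∧
    HasDensity P (fun ω => a * (E ω - 1) - b * (E' ω - 1))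
      (fun x => lapPDF b a (-x - (a - b))) := by
  obtain ⟨h1, h2, _⟩ := Y_half hE' hE hind.symm hb ha hba
  have hd := Y_density hE' hE hind.symm hb ha
  have hn := hd_prob_neg hd
  have e : ∀ ω, -(b * (E' ω - 1) - a * (E ω - 1)) = a * (E ω - 1) - b * (E' ω - 1) := by
    intro ω; ring
  have hd' := hd_neg hd
  simp only [e] at hn hd'
  refine ⟨by rw [hn, h1], ?_, hd'⟩
  rw [← h2]
  congr 1; ext ω
  rw [← e ω, abs_neg]

lemma hd_pos {X : Ω → ℝ} {f : ℝ → ℝ} (hX : HasDensity P X f) (hf : Measurable f)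
    (hf0 : ∀ x, 0 ≤ f x) (hXi : Integrable X P) (hm : ∫ ω, X ω ∂P = 0)
    (hL : 0 < ∫ ω, |X ω| ∂P) : 0 < P.real {ω | 0 < X ω} := by
  obtain ⟨d1, d2, d3, d4⟩ := hd_data hX hf hf0 hXi hm
  refine lt_of_le_of_ne measureReal_nonneg fun h => ?_
  rw [d3] at h
  have := (integral_eq_zero_iff_of_nonneg_ae (by filter_upwards with x using hf0 x) d1).1 h.symm
  have h2 : ∫ x in Ioi (0:ℝ), x * f x = 0 := by
    rw [integral_eq_zero_of_ae]
    filter_upwards [this] with x hx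
    simp [hx]
  rw [d4, h2] at hL
  simp at hL

lemma finish {X Y : Ω → ℝ} {f g ψ : ℝ → ℝ} (hX : HasDensity P X f) (hf : Measurable f)
    (hf0 : ∀ x, 0 ≤ f x) (hXi : Integrable X P) (hXm : ∫ ω, X ω ∂P = 0)
    (hY : HasDensity P Y g) (hg : Measurable g)
    (hg0 : ∀ x, 0 ≤ g x) (hYi : Integrable Y P) (hYm : ∫ ω, Y ω ∂P = 0)
    (hp : P.real {ω | 0 < X ω} = P.real {ω | 0 < Y ω})
    (hL : ∫ ω, |X ω| ∂P = ∫ ω, |Y ω| ∂P)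
    (hψ : ConvexOn ℝ (Ioi 0) ψ) (hψ0 : ∀ x ≤ (0:ℝ), ψ x = 0)
    (hXψ : Integrable (fun ω => ψ (X ω)) P) (hYψ : Integrable (fun ω => ψ (Y ω)) P)
    (hS : ∀ x y z, 0 < x → x < y → y < z → g x < f x → g z < f z → g y ≤ f y) :
    ∫ ω, ψ (X ω) ∂P ≤ ∫ ω, ψ (Y ω) ∂P := by
  have hψm : Measurable ψ := by
    have hc : ContinuousOn ψ (Ioi 0) := hψ.continuousOn isOpen_Ioi
    have : ψ = (Ioi (0:ℝ)).piecewise ψ (fun _ => 0) := by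
      ext x
      by_cases hx : x ∈ Ioi (0:ℝ)
      · rw [piecewise_eq_of_mem _ _ _ hx]
      · rw [piecewise_eq_of_notMem _ _ _ hx]
        exact hψ0 x (not_lt.1 hx)
    rw [this]
    exact hc.measurable_piecewise continuousOn_const measurableSet_Ioi
  obtain ⟨d1, d2, d3, d4⟩ := hd_data hX hf hf0 hXi hXm
  obtain ⟨k1, k2, k3, k4⟩ := hd_data hY hg hg0 hYi hYm
  have hz : ∀ h : ℝ → ℝ, ∫ x, ψ x * h x = ∫ x in Ioi (0:ℝ), ψ x * h x := by
    intro h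
    symm
    apply setIntegral_eq_integral_of_forall_compl_eq_zero
    intro x hx
    rw [hψ0 x (not_lt.1 hx), zero_mul]
  rw [hd_integral hX hf hf0 hψm, hd_integral hY hg hg0 hψm, hz, hz]
  refine crossing hψ d1 d2 k1 k2 (by rw [← d3, ← k3, hp]) (by linarith) ?_ ?_ hS
  · exact ((hd_integrable hX hf hf0 hψm).1 hXψ).integrableOn
  · exact ((hd_integrable hY hg hg0 hψm).1 hYψ).integrableOn

lemma convex_scale {ψ : ℝ → ℝ} (hψ : ConvexOn ℝ (Ioi 0) ψ) {m : ℝ} (hm : 0 < m) :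
    ConvexOn ℝ (Ioi 0) (fun x => ψ (x / m)) := by
  refine ⟨convex_Ioi 0, fun x hx y hy s t hs ht hst => ?_⟩
  have := hψ.2 (show x / m ∈ Ioi (0:ℝ) from div_pos hx hm)
    (show y / m ∈ Ioi (0:ℝ) from div_pos hy hm) hs ht hst
  have e : (s • x + t • y) / m = s • (x / m) + t • (y / m) := by
    simp only [smul_eq_mul]; ring
  simp only [e]; exact this

end final

theorem stmt_7 {Ω : Type} [MeasurableSpace Ω] (P : Measure Ω) [IsProbabilityMeasure P]
    (X : Ω → ℝ) (f : ℝ → ℝ) (hf : IsLogConcaveFn f) (hX : HasDensity P X f)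
    (hmean : (∫ ω, X ω ∂P) = 0) (hL1 : 0 < ∫ ω, |X ω| ∂P)
    (E E' : Ω → ℝ) (hE : HasDensity P E expPDF) (hE' : HasDensity P E' expPDF)
    (hind : IndepFun E E' P)
    (ψ : ℝ → ℝ) (hψconv : ConvexOn ℝ (Set.Ioi 0) ψ) (hψ0 : ∀ x ≤ (0 : ℝ), ψ x = 0) :
    (∃! ab : ℝ × ℝ, 0 ≤ ab.1 ∧ 0 ≤ ab.2 ∧
        P {ω | 0 < X ω} = P {ω | 0 < ab.1 * (E ω - 1) - ab.2 * (E' ω - 1)} ∧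
        (∫ ω, |X ω| ∂P) = ∫ ω, |ab.1 * (E ω - 1) - ab.2 * (E' ω - 1)| ∂P) ∧
    (∀ a b : ℝ, 0 ≤ a → 0 ≤ b →
        P {ω | 0 < X ω} = P {ω | 0 < a * (E ω - 1) - b * (E' ω - 1)} →
        (∫ ω, |X ω| ∂P) = (∫ ω, |a * (E ω - 1) - b * (E' ω - 1)| ∂P) →
        Integrable (fun ω => ψ (X ω / ∫ ω', |X ω'| ∂P)) P →
        Integrable (fun ω =>
          ψ ((a * (E ω - 1) - b * (E' ω - 1)) /
            ∫ ω', |a * (E ω' - 1) - b * (E' ω' - 1)| ∂P)) P →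
        (∫ ω, ψ (X ω / ∫ ω', |X ω'| ∂P) ∂P) ≤
          ∫ ω, ψ ((a * (E ω - 1) - b * (E' ω - 1)) /
            ∫ ω', |a * (E ω' - 1) - b * (E' ω' - 1)| ∂P) ∂P) := by
  have hfm := lc_measurable hf
  have hXi : Integrable X P := by
    by_contra h
    have h' : ¬ Integrable (fun ω => |X ω|) P := by
      intro h2
      exact h ((integrable_norm_iff hX.1.aestronglyMeasurable).1 h2)
    rw [integral_undef h'] at hL1
    exact lt_irrefl _ hL1
  obtain ⟨d1, d2, d3, d4⟩ := hd_data hX hfm hf.1 hXi hmean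
  have hX' := hd_neg hX
  have hf' := lc_neg hf
  have hXi' : Integrable (fun ω => - X ω) P := hXi.neg
  have hm' : ∫ ω, - X ω ∂P = 0 := by rw [integral_neg, hmean, neg_zero]
  obtain ⟨n1, n2, n3, n4⟩ := hd_data hX' (lc_measurable hf') hf'.1 hXi' hm'
  simp only [abs_neg] at n4
  have hp0 := hd_pos hX hfm hf.1 hXi hmean hL1
  have hq0 := hd_pos hX' (lc_measurable hf') hf'.1 hXi' hm' (by simpa only [abs_neg] using hL1)
  rw [hd_prob_neg hX] at hq0 n3
  set p := P.real {ω | 0 < X ω} with hp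
  set M := ∫ x in Ioi (0:ℝ), x * f x with hM
  have hM0 : 0 < M := by linarith
  have hM' : ∫ x in Ioi (0:ℝ), x * f (-x) = M := by linarith
  have g1 : Real.exp (-1) ≤ p :=
    grunbaum hf hM0 hp0 d1 d2 d3.symm rfl n1 n2 n3.symm hM'
  have g2 : Real.exp (-1) ≤ 1 - p :=
    grunbaum hf' hM0 hq0 n1 n2 n3.symm hM' (by simpa using d1) (by simpa using d2)
      (by simp only [neg_neg]; rw [← d3]; ring) (by simp only [neg_neg]; rfl)
  have hreal : ∀ S : Set Ω, P {ω | 0 < X ω} = P S ↔ p = P.real S := by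
    intro S
    rw [hp, measureReal_def, measureReal_def,
      ENNReal.toReal_eq_toReal_iff' (measure_ne_top _ _) (measure_ne_top _ _)]
  -- characterisation of valid pairs
  have char : ∀ a b : ℝ, 0 ≤ a → 0 ≤ b →
      P {ω | 0 < X ω} = P {ω | 0 < a * (E ω - 1) - b * (E' ω - 1)} →
      (∫ ω, |X ω| ∂P) = (∫ ω, |a * (E ω - 1) - b * (E' ω - 1)| ∂P) →
      (b ≤ a ∧ 0 < a ∧ p = Kfun (b / a) ∧ M = p * a) ∨
      (a < b ∧ 1 - p = Kfun (a / b) ∧ M = (1 - p) * b) := by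
    intro a b ha hb h1 h2
    rw [hreal] at h1
    rcases le_or_gt b a with hba | hab
    · left
      have ha0 : 0 < a := by
        rcases ha.eq_or_lt with h | h
        · exfalso
          have hb0 : b = 0 := by linarith
          rw [h2, ← h, hb0] at hL1
          simp at hL1
        · exact h
      obtain ⟨y1, y2, _⟩ := Y_half hE hE' hind ha0 hb hba
      rw [y1] at h1
      rw [y2, d4, ← h1] at h2
      exact ⟨hba, ha0, h1, by linarith⟩
    · right
      obtain ⟨y1, y2, _⟩ := Y_half' hE hE' hind (by linarith) ha hab.le
      rw [y1] at h1
      have h1' : 1 - p = Kfun (a / b) := by linarith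
      rw [y2, d4, ← h1'] at h2
      exact ⟨hab, h1', by linarith⟩
  have Kle : ∀ t, 0 ≤ t → t ≤ 1 → Kfun t ≤ 1 / 2 := by
    intro t h0 h1
    rw [← Kfun_one]
    exact Kfun_strictMono.monotoneOn (show (0:ℝ) ≤ t from h0) (show (0:ℝ) ≤ 1 from zero_le_one) h1
  have Klt : ∀ t, 0 ≤ t → t < 1 → Kfun t < 1 / 2 := by
    intro t h0 h1
    rw [← Kfun_one]
    exact Kfun_strictMono (show (0:ℝ) ≤ t from h0) (show (0:ℝ) ≤ 1 from zero_le_one) h1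
  refine ⟨?_, ?_⟩
  · apply existsUnique_of_exists_of_unique
    · rcases le_or_gt p (1 / 2) with hph | hph
      · obtain ⟨t, t0, t1, ht⟩ := Kfun_surj g1 hph
        have ha : 0 < M / p := by positivity
        refine ⟨(M / p, t * (M / p)), ha.le, by positivity, ?_⟩
        obtain ⟨y1, y2, _⟩ := Y_half hE hE' hind ha (show 0 ≤ t * (M / p) by positivity)
          (by nlinarith)
        have e : t * (M / p) / (M / p) = t := by field_simp
        rw [e, ht] at y1 y2
        refine ⟨(hreal _).2 y1.symm, ?_⟩
        rw [d4]
        refine Eq.trans ?_ y2.symm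
        field_simp
      · obtain ⟨t, t0, t1, ht⟩ := Kfun_surj g2 (by linarith)
        have hb : 0 < M / (1 - p) := by positivity
        refine ⟨(t * (M / (1 - p)), M / (1 - p)), by positivity, hb.le, ?_⟩
        obtain ⟨y1, y2, _⟩ := Y_half' hE hE' hind hb
          (show 0 ≤ t * (M / (1 - p)) by positivity) (by nlinarith)
        have e : t * (M / (1 - p)) / (M / (1 - p)) = t := by field_simp
        rw [e, ht] at y1 y2
        refine ⟨(hreal _).2 (by rw [y1]; ring), ?_⟩
        rw [d4]
        refine Eq.trans ?_ y2.symm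
        field_simp
    · rintro ⟨a, b⟩ ⟨a', b'⟩ ⟨ha, hb, h1, h2⟩ ⟨ha', hb', h1', h2'⟩
      simp only at ha hb h1 h2 ha' hb' h1' h2'
      rcases char a b ha hb h1 h2 with ⟨c1, c2, c3, c4⟩ | ⟨c1, c3, c4⟩ <;>
      rcases char a' b' ha' hb' h1' h2' with ⟨k1, k2, k3, k4⟩ | ⟨k1, k3, k4⟩
      · have haa : a = a' := by
          apply mul_left_cancel₀ hp0.ne'; linarith
        subst haa
        have := Kfun_strictMono.injOn (show (0:ℝ) ≤ b / a by positivity)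
          (show (0:ℝ) ≤ b' / a by positivity) (c3.symm.trans k3)
        rw [div_left_inj' c2.ne'] at this
        rw [this]
      · exfalso
        have := Kle (b / a) (by positivity) (by rw [div_le_one c2]; exact c1)
        have := Klt (a' / b') (by positivity) (by rw [div_lt_one (by linarith)]; exact k1)
        linarith
      · exfalso
        have := Kle (b' / a') (by positivity) (by rw [div_le_one k2]; exact k1)
        have := Klt (a / b) (by positivity) (by rw [div_lt_one (by linarith)]; exact c1)
        linarith
      · have hbb : b = b' := by
          apply mul_left_cancel₀ hq0.ne'; linarith
        subst hbb
        have := Kfun_strictMono.injOn (show (0:ℝ) ≤ a / b by positivity)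
          (show (0:ℝ) ≤ a' / b by positivity) (c3.symm.trans k3)
        rw [div_left_inj' (by linarith : b ≠ 0)] at this
        rw [this]
  · intro a b ha hb h1 h2 i1 i2
    have hc := char a b ha hb h1 h2
    rw [← h2] at i2 ⊢
    set m := ∫ ω, |X ω| ∂P with hmdef
    have hψc := convex_scale hψconv hL1
    have hψz : ∀ x ≤ (0:ℝ), (fun x => ψ (x / m)) x = 0 := fun x hx =>
      hψ0 _ (div_nonpos_of_nonpos_of_nonneg hx hL1.le)
    obtain ⟨yi, ym⟩ := Y_mean hE hE' a b
    have h1r := (hreal _).1 h1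
    rcases hc with ⟨c1, c2, c3, c4⟩ | ⟨c1, c3, c4⟩
    · have hden := Y_density hE hE' hind c2 hb
      refine finish (ψ := fun x => ψ (x / m)) hX hfm hf.1 hXi hmean hden
        ((lapPDF_measurable a b).comp (measurable_sub_const _)) (fun x => lapPDF_nonneg c2 hb _)
        yi ym h1r h2 hψc hψz i1 i2 ?_
      intro x y z hx hxy hyz hgx hgz
      rw [lap_form c2 hb x (by linarith)] at hgx
      rw [lap_form c2 hb z (by linarith)] at hgz
      rw [lap_form c2 hb y (by linarith)]
      rw [← c3] at *
      exact lc_between hf (by positivity) hxy hyz hgx.le hgz.le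
    · have hb0 : 0 < b := by linarith
      obtain ⟨_, _, hden⟩ := Y_half' hE hE' hind hb0 ha c1.le
      refine finish (ψ := fun x => ψ (x / m)) hX hfm hf.1 hXi hmean hden
        ((lapPDF_measurable b a).comp (by fun_prop)) (fun x => lapPDF_nonneg hb0 ha _)
        yi ym h1r h2 hψc hψz i1 i2 ?_
      intro x y z hx hxy hyz hgx hgz
      have hxb : b - a ≤ x := by
        by_contra! hlt
        have k := key_left' hf' hb0 hq0 n1 n2 n3.symm (by rw [hM', c4]) (-x) (by linarith)
        rw [lap_form hb0 ha (-x) (by linarith), ← c3] at hgx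
        simp only [neg_neg] at k
        linarith
      rcases ha.eq_or_lt with ha0 | ha0
      · have : lapPDF b a (-y - (a - b)) = 0 := by
          have h : ¬ (0 < -y - (a - b)) := by linarith
          rw [lapPDF, if_neg h, if_pos ha0.symm]
        rw [this]; exact hf.1 y
      · have form : ∀ w, b - a ≤ w → lapPDF b a (-w - (a - b))
            = Real.exp ((b - a) / a) / (a + b) * Real.exp (-a⁻¹ * w) := by
          intro w hw
          have h : ¬ (0 < -w - (a - b)) := by linarith
          simp only [lapPDF, h, if_false, ha0.ne']
          have e1 : (-w - (a - b)) / a = (b - a) / a + -a⁻¹ * w := by field_simp; ring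
          rw [e1, Real.exp_add, add_comm b a]
          ring
        rw [form x hxb] at hgx
        rw [form z (by linarith)] at hgz
        rw [form y (by linarith)]
        exact lc_between hf (by positivity) hxy hyz hgx.le hgz.le
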